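/- Fix a real number σ with 0 ≤ σ < 1 and let k, s ∈ [−1,1]. Then the function z ↦ exp(−z)·g(s,k,z) is strictly decreasing on (0,∞); equivalently, the partial derivative of g with respect to z satisfies g_z(s,k,z) − g(s,k,z) < 0 for all z > 0. -/

import Mathlib

noncomputable section

open Real

/-- `F(z) = ((3+σ)/2)·sinh(2z) − (1−σ)·z`. -/
def F (σ z : ℝ) : ℝ := ((3 + σ) / 2) * Real.sinh (2 * z) - (1 - σ) * z

/-- `F̄(z) = ((3+σ)/2)·sinh(2z) + (1−σ)·z`. -/
def Fbar (σ z : ℝ) : ℝ := ((3 + σ) / 2) * Real.sinh (2 * z) + (1 - σ) * z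

/-- `ψ(k,z)`. -/
def psi (σ k z : ℝ) : ℝ :=
  (2 + (1 - σ) * z) * Real.cosh (k * z) * Real.cosh z
    + (-(1 + σ) + (1 - σ) * z) * Real.cosh (k * z) * Real.sinh z
    - (1 - σ) * k * z * Real.sinh (k * z) * Real.cosh z
    - (1 - σ) * k * z * Real.sinh (k * z) * Real.sinh z

/-- `ξ(k,z)`. -/
def xi (σ k z : ℝ) : ℝ :=
  -(1 - σ) * k * z * Real.cosh (k * z) * Real.cosh z
    - (1 - σ) * k * z * Real.cosh (k * z) * Real.sinh z
    + (-(1 + σ) + (1 - σ) * z) * Real.sinh (k * z) * Real.cosh z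
    + (2 + (1 - σ) * z) * Real.sinh (k * z) * Real.sinh z

/-- `ζ(k,z)`. -/
def zeta (σ k z : ℝ) : ℝ :=
  (4 / (1 - σ) - (1 + σ) * z) * Real.cosh (k * z) * Real.cosh z
    + ((1 + σ) ^ 2 / (1 - σ) + 2 * z) * Real.cosh (k * z) * Real.sinh z
    - 2 * k * z * Real.sinh (k * z) * Real.cosh z
    + (1 + σ) * k * z * Real.sinh (k * z) * Real.sinh z

/-- `η(k,z)`. -/
def eta (σ k z : ℝ) : ℝ :=
  (1 + σ) * k * z * Real.cosh (k * z) * Real.cosh z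
    - 2 * k * z * Real.cosh (k * z) * Real.sinh z
    + ((1 + σ) ^ 2 / (1 - σ) + 2 * z) * Real.sinh (k * z) * Real.cosh z
    + (4 / (1 - σ) - (1 + σ) * z) * Real.sinh (k * z) * Real.sinh z

/-- `g(s,k,z)`. -/
def g (σ s k z : ℝ) : ℝ :=
  Real.cosh (s * z) *
      (zeta σ k z / F σ z + z * psi σ k z / F σ z - s * z * xi σ k z / Fbar σ z)
    + Real.sinh (s * z) *
      (eta σ k z / Fbar σ z + z * xi σ k z / Fbar σ z - s * z * psi σ k z / F σ z)

/-- `h(s,k,z) = (1+z·|k−s|)·exp(−z·|k−s|)`. -/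
def hfun (s k z : ℝ) : ℝ := (1 + z * |k - s|) * Real.exp (-(z * |k - s|))

/-- `φ(s,k,z) = exp(−z)·g(s,k,z) + h(s,k,z)`. -/
def phi (σ s k z : ℝ) : ℝ := Real.exp (-z) * g σ s k z + hfun s k z

/-- The rescaled profile `(1/2 + (1-s)z) e^{-(1-s)z} + (μ/2) e^{-(3+s)z}`. -/
def edgeProfile (μ s z : ℝ) : ℝ :=
  (1 / 2 + (1 - s) * z) * exp (-((1 - s) * z)) + μ / 2 * exp (-((3 + s) * z))

/-- The weight `e^{2z} / ((μ/2 · sinh 2z)² - z²)`. -/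
def edgeWeight (μ z : ℝ) : ℝ := exp (2 * z) / ((μ / 2 * sinh (2 * z)) ^ 2 - z ^ 2)

/-- The part of `exp (-z) * g` pairing profiles of the same orientation. -/
def sameEdge (μ s k z : ℝ) : ℝ :=
  edgeWeight μ z * (μ / 2 * sinh (2 * z)) * (edgeProfile μ s z * edgeProfile μ k z)
    + μ * exp (-((2 - s - k) * z))

/-- The part of `exp (-z) * g` pairing profiles of opposite orientation. -/
def oppositeEdge (μ s k z : ℝ) : ℝ :=
  edgeWeight μ z * z * (edgeProfile μ s z * edgeProfile μ (-k) z)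

lemma sinh_le_mul_cosh {x : ℝ} (hx : 0 ≤ x) : sinh x ≤ x * cosh x := by
  have hmono : MonotoneOn (fun y : ℝ => y * cosh y - sinh y) (Set.Ici 0) := by
    apply monotoneOn_of_deriv_nonneg (convex_Ici 0)
    · fun_prop
    · fun_prop
    · intro y hy
      rw [interior_Ici] at hy
      have hd : HasDerivAt (fun y : ℝ => y * cosh y - sinh y)
          (1 * cosh y + y * sinh y - cosh y) y :=
        ((hasDerivAt_id y).mul (hasDerivAt_cosh y)).sub (hasDerivAt_sinh y)
      rw [hd.deriv]
      have := mul_nonneg (le_of_lt hy) (sinh_nonneg_iff.2 (le_of_lt hy))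
      linarith
  have h := hmono (Set.mem_Ici.2 le_rfl) (Set.mem_Ici.2 hx) hx
  simp only [zero_mul, sinh_zero, sub_zero] at h
  linarith

lemma add_mul_sinh_le {x : ℝ} (hx : 0 < x) : (6 / 5 + x) * sinh x ≤ 2 * x * cosh x := by
  have hs : 0 < sinh x := sinh_pos_iff.2 hx
  have hsc : sinh x < cosh x := sinh_lt_cosh x
  rcases le_total x (4 / 5) with h | h
  · nlinarith [sinh_le_mul_cosh hx.le]
  rcases le_total (6 / 5) x with h' | h'
  · nlinarith
  have he : exp (-1) ≥ 9 / 25 := by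
    have := exp_neg_one_gt_d9
    linarith
  have h2 : exp (-2) ≥ 1 / 8 := by
    have : exp (-2) = exp (-1) * exp (-1) := by rw [← exp_add]; norm_num
    nlinarith
  have htan : exp (-(2 * x)) ≥ 1 / 8 * (3 - 2 * x) := by
    have h1 : exp (-(2 * x)) = exp (-2) * exp (2 - 2 * x) := by rw [← exp_add]; ring_nf
    have h3 := add_one_le_exp (2 - 2 * x)
    rw [h1]
    nlinarith [exp_pos (2 - 2 * x)]
  have hprod : exp x * exp (-(2 * x)) = exp (-x) := by rw [← exp_add]; ring_nf
  have key : 0 ≤ exp (-(2 * x)) * (3 * x + 6 / 5) - (6 / 5 - x) := by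
    nlinarith [mul_le_mul_of_nonneg_right htan (by linarith : (0 : ℝ) ≤ 3 * x + 6 / 5)]
  have := mul_nonneg (exp_pos x).le key
  rw [sinh_eq, cosh_eq]
  rw [← hprod]
  nlinarith

section Weight

variable {μ z : ℝ}

lemma mul_le_half_mul_sinh (hμ : 0 ≤ μ) (hz : 0 ≤ z) : μ * z ≤ μ / 2 * sinh (2 * z) := by
  have := self_le_sinh_iff.2 (by linarith : 0 ≤ 2 * z)
  nlinarith

lemma edgeDenominator_pos (hμ : 1 < μ) (hz : 0 < z) :
    0 < (μ / 2 * sinh (2 * z)) ^ 2 - z ^ 2 := by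
  have := mul_le_half_mul_sinh (by linarith : 0 ≤ μ) hz.le
  have : z < μ / 2 * sinh (2 * z) := by nlinarith
  nlinarith

lemma edgeWeight_pos (hμ : 1 < μ) (hz : 0 < z) : 0 < edgeWeight μ z :=
  div_pos (exp_pos _) (edgeDenominator_pos hμ hz)

lemma hasDerivAt_half_mul_sinh (μ z : ℝ) :
    HasDerivAt (fun z => μ / 2 * sinh (2 * z)) (μ * cosh (2 * z)) z := by
  have h := (((hasDerivAt_id z).const_mul 2).sinh).const_mul (μ / 2)
  exact h.congr_deriv (by simp only [id]; ring)

/-- The logarithmic derivative of `edgeWeight` is at most `2 - 4 coth 2z`. -/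
lemma exists_hasDerivAt_edgeWeight (hμ : 1 < μ) (hz : 0 < z) :
    ∃ q, HasDerivAt (edgeWeight μ) (q * edgeWeight μ z) z ∧
      q * sinh (2 * z) ≤ 2 * sinh (2 * z) - 4 * cosh (2 * z) := by
  have hD := edgeDenominator_pos hμ hz
  have hexp : HasDerivAt (fun z : ℝ => exp (2 * z)) (exp (2 * z) * (2 * 1)) z :=
    ((hasDerivAt_id z).const_mul 2).exp
  have hsq : HasDerivAt (fun z : ℝ => (μ / 2 * sinh (2 * z)) ^ 2 - z ^ 2)
      (2 * (μ / 2 * sinh (2 * z)) * (μ * cosh (2 * z)) - 2 * z) z := by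
    have h := ((hasDerivAt_half_mul_sinh μ z).pow 2).sub ((hasDerivAt_id z).pow 2)
    exact h.congr_deriv (by simp)
  have hs : 0 < sinh (2 * z) := sinh_pos_iff.2 (by linarith)
  have hsc := sinh_le_mul_cosh (by linarith : 0 ≤ 2 * z)
  refine ⟨2 - (2 * (μ / 2 * sinh (2 * z)) * (μ * cosh (2 * z)) - 2 * z) /
    ((μ / 2 * sinh (2 * z)) ^ 2 - z ^ 2), ?_, ?_⟩
  · refine HasDerivAt.congr_deriv (hexp.div hsq hD.ne') ?_
    have hD' := hD.ne'
    unfold edgeWeight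
    set D := (μ / 2 * sinh (2 * z)) ^ 2 - z ^ 2
    field_simp
  · rw [sub_mul, div_mul_eq_mul_div]
    apply sub_le_sub_left
    rw [le_div_iff₀ hD]
    nlinarith

end Weight

section Profile

variable {μ s z : ℝ}

lemma edgeProfile_pos (hμ : 0 ≤ μ) (hs : s ≤ 1) (hz : 0 ≤ z) : 0 < edgeProfile μ s z := by
  have : 0 ≤ (1 - s) * z := mul_nonneg (by linarith) hz
  unfold edgeProfile
  positivity

lemma hasDerivAt_edgeProfile (μ s z : ℝ) :
    HasDerivAt (edgeProfile μ s)
      ((1 - s) * (1 / 2 - (1 - s) * z) * exp (-((1 - s) * z))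
        - (3 + s) * (μ / 2 * exp (-((3 + s) * z)))) z := by
  have h1 : HasDerivAt (fun z : ℝ => (1 - s) * z) ((1 - s) * 1) z :=
    (hasDerivAt_id z).const_mul (1 - s)
  have h2 : HasDerivAt (fun z : ℝ => (3 + s) * z) ((3 + s) * 1) z :=
    (hasDerivAt_id z).const_mul (3 + s)
  have h := ((h1.const_add (1 / 2)).mul h1.neg.exp).add (h2.neg.exp.const_mul (μ / 2))
  exact h.congr_deriv (by simp only [Pi.neg_apply]; ring)

lemma mul_deriv_edgeProfile_lt (hμ : 0 ≤ μ) (hs : -1 ≤ s) (hz : 0 < z) :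
    z * ((1 - s) * (1 / 2 - (1 - s) * z) * exp (-((1 - s) * z))
        - (3 + s) * (μ / 2 * exp (-((3 + s) * z)))) < 1 / 10 * edgeProfile μ s z := by
  unfold edgeProfile
  have h1 : 0 ≤ z * (3 + s) * (μ / 2 * exp (-((3 + s) * z))) := by
    have : 0 ≤ 3 + s := by linarith
    positivity
  have h2 : 0 ≤ μ / 2 * exp (-((3 + s) * z)) := by positivity
  set u := (1 - s) * z
  have h3 : u * (1 / 2 - u) < 1 / 10 * (1 / 2 + u) := by nlinarith [sq_nonneg (u - 1 / 5)]
  have h4 := mul_lt_mul_of_pos_right h3 (exp_pos (-u))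
  have h5 : z * ((1 - s) * (1 / 2 - u) * exp (-u)) = u * (1 / 2 - u) * exp (-u) := by
    simp only [u]; ring
  nlinarith

end Profile

lemma exists_hasDerivAt_oppositeEdge {μ s k z : ℝ} (hμ : 1 < μ) (hs : s ∈ Set.Icc (-1 : ℝ) 1)
    (hk : k ∈ Set.Icc (-1 : ℝ) 1) (hz : 0 < z) :
    ∃ d < 0, HasDerivAt (oppositeEdge μ s k) d z := by
  obtain ⟨q, hq, hqle⟩ := exists_hasDerivAt_edgeWeight hμ hz
  have hμ0 : 0 ≤ μ := by linarith
  have hQ := edgeWeight_pos hμ hz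
  have hws := edgeProfile_pos hμ0 hs.2 hz.le
  have hwk := edgeProfile_pos hμ0 (by linarith [hk.1] : -k ≤ 1) hz.le
  have hds := mul_deriv_edgeProfile_lt hμ0 hs.1 hz
  have hdk := mul_deriv_edgeProfile_lt hμ0 (by linarith [hk.2] : -1 ≤ -k) hz
  have hDs := hasDerivAt_edgeProfile μ s z
  have hDk := hasDerivAt_edgeProfile μ (-k) z
  set ds := (1 - s) * (1 / 2 - (1 - s) * z) * exp (-((1 - s) * z))
        - (3 + s) * (μ / 2 * exp (-((3 + s) * z)))
  set dk := (1 - -k) * (1 / 2 - (1 - -k) * z) * exp (-((1 - -k) * z))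
        - (3 + -k) * (μ / 2 * exp (-((3 + -k) * z)))
  have hq' : q * z + 1 ≤ -(1 / 5) := by
    have h1 := add_mul_sinh_le (by linarith : 0 < 2 * z)
    have h2 : 0 < sinh (2 * z) := sinh_pos_iff.2 (by linarith)
    refine le_of_mul_le_mul_right ?_ h2
    nlinarith [mul_le_mul_of_nonneg_left hqle hz.le]
  refine ⟨_, ?_, (hq.mul (hasDerivAt_id z)).mul (hDs.mul hDk)⟩
  simp only [id, Pi.mul_apply]
  set Q := edgeWeight μ z
  set ws := edgeProfile μ s z
  set wk := edgeProfile μ (-k) z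
  have e1 := mul_lt_mul_of_pos_right hds (mul_pos hQ hwk)
  have e2 := mul_lt_mul_of_pos_right hdk (mul_pos hQ hws)
  have e3 := mul_le_mul_of_nonneg_right hq' (mul_pos hQ (mul_pos hws hwk)).le
  nlinarith

/-- The algebraic inequality behind the monotonicity of `sameEdge`. -/
lemma same_edge_inequality {μ z t R r u v m n : ℝ} (hμ : 3 ≤ μ) (hR : 0 < R)
    (ht0 : 0 < t) (ht1 : t < 1) (hu : 0 ≤ u) (hv : 0 ≤ v) (huz : u ≤ 2 * z) (hvz : v ≤ 2 * z)
    (hm : 0 ≤ m) (hn : 0 ≤ n) (hr : r * (1 - t) ≤ -(4 * z * t))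
    (hRle : R * (1 - t) * (μ ^ 2 - 1) ≤ 4 * μ) :
    R * (r * ((1 / 2 + u + m) * (1 / 2 + v + n))
      + (u * (1 / 2 - u) - (4 * z - u) * m) * (1 / 2 + v + n)
      + (v * (1 / 2 - v) - (4 * z - v) * n) * (1 / 2 + u + m)) ≤ μ * (u + v) := by
  have hz : 0 ≤ z := by linarith
  have hgrow : (u * (1 / 2 - u) - (4 * z - u) * m) * (1 / 2 + v + n)
      + (v * (1 / 2 - v) - (4 * z - v) * n) * (1 / 2 + u + m) ≤ (u + v) / 4 := by
    have h1 : 0 ≤ m * ((1 / 2 + v) * (4 * z - u) - v * (1 / 2 - v)) := by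
      apply mul_nonneg hm; nlinarith
    have h2 : 0 ≤ n * ((1 / 2 + u) * (4 * z - v) - u * (1 / 2 - u)) := by
      apply mul_nonneg hn; nlinarith
    have h3 : 0 ≤ m * n := mul_nonneg hm hn
    have h4 : 0 ≤ u * v := mul_nonneg hu hv
    nlinarith [sq_nonneg (u - v), mul_nonneg h4 (add_nonneg hu hv),
      mul_nonneg h3 (by linarith : 0 ≤ 4 * z - u), mul_nonneg h3 (by linarith : 0 ≤ 4 * z - v)]
  have hω : 1 / 4 ≤ (1 / 2 + u + m) * (1 / 2 + v + n) := by nlinarith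
  have hμuv : 0 ≤ μ * (u + v) := by nlinarith
  have hr0 : r ≤ 0 := by
    by_contra! h
    nlinarith [mul_pos h (sub_pos.2 ht1), mul_nonneg hz ht0.le]
  have hrω : r * ((1 / 2 + u + m) * (1 / 2 + v + n)) ≤ r * (1 / 4) :=
    mul_le_mul_of_nonpos_left hω hr0
  rcases le_total (1 / 2) t with ht | ht
  · have hr1 : r ≤ -(4 * z) := by
      refine le_of_mul_le_mul_right (hr.trans ?_) (sub_pos.2 ht1)
      nlinarith
    refine le_trans ?_ hμuv
    apply mul_nonpos_of_nonneg_of_nonpos hR.le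
    linarith
  · have hRμ : R ≤ μ := by
      have h1 : R * (1 / 2) * (μ ^ 2 - 1) ≤ 4 * μ := by
        refine le_trans ?_ hRle
        have : 0 ≤ μ ^ 2 - 1 := by nlinarith
        gcongr
        linarith
      have : R * (1 / 2) * 8 ≤ R * (1 / 2) * (μ ^ 2 - 1) := by
        gcongr
        nlinarith
      linarith
    have := mul_le_mul_of_nonneg_left
      (by linarith : r * ((1 / 2 + u + m) * (1 / 2 + v + n))
        + (u * (1 / 2 - u) - (4 * z - u) * m) * (1 / 2 + v + n)
        + (v * (1 / 2 - v) - (4 * z - v) * n) * (1 / 2 + u + m) ≤ u + v) hR.le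
    exact this.trans (by gcongr)

lemma exists_hasDerivAt_sameEdge {μ s k z : ℝ} (hμ : 3 ≤ μ) (hs : s ∈ Set.Icc (-1 : ℝ) 1)
    (hk : k ∈ Set.Icc (-1 : ℝ) 1) (hz : 0 < z) :
    ∃ d ≤ 0, HasDerivAt (sameEdge μ s k) d z := by
  have hμ1 : 1 < μ := by linarith
  obtain ⟨q, hq, hqle⟩ := exists_hasDerivAt_edgeWeight hμ1 hz
  have hQ := edgeWeight_pos hμ1 hz
  have hsinh : 0 < sinh (2 * z) := sinh_pos_iff.2 (by linarith)
  have hlin : HasDerivAt (fun z : ℝ => (2 - s - k) * z) ((2 - s - k) * 1) z :=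
    (hasDerivAt_id z).const_mul (2 - s - k)
  refine ⟨_, ?_, ((hq.mul (hasDerivAt_half_mul_sinh μ z)).mul
    ((hasDerivAt_edgeProfile μ s z).mul (hasDerivAt_edgeProfile μ k z))).add
    (hlin.neg.exp.const_mul μ)⟩
  refine nonpos_of_mul_nonpos_right ?_ hz
  simp only [Pi.mul_apply, Pi.neg_apply]
  set t := exp (-(4 * z)) with ht
  have ht1 : t < 1 := by rw [ht, exp_lt_one_iff]; linarith
  have hexp2 : exp (-(2 * z)) = t * exp (2 * z) := by rw [ht, ← exp_add]; ring_nf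
  have hsinh_eq : sinh (2 * z) = exp (2 * z) * (1 - t) / 2 := by
    rw [sinh_eq, hexp2]; ring
  have hcosh_eq : cosh (2 * z) = exp (2 * z) * (1 + t) / 2 := by
    rw [cosh_eq, hexp2]; ring
  set u := (1 - s) * z with hu
  set v := (1 - k) * z with hv
  have h3s : exp (-((3 + s) * z)) = exp (-u) * exp (2 * u - 4 * z) := by
    rw [← exp_add, hu]; ring_nf
  have h3k : exp (-((3 + k) * z)) = exp (-v) * exp (2 * v - 4 * z) := by
    rw [← exp_add, hv]; ring_nf
  have huv : exp (-((2 - s - k) * z)) = exp (-u) * exp (-v) := by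
    rw [← exp_add, hu, hv]; ring_nf
  have hratio : cosh (2 * z) / sinh (2 * z) * sinh (2 * z) = cosh (2 * z) :=
    div_mul_cancel₀ _ hsinh.ne'
  have key := same_edge_inequality (μ := μ) (z := z) (t := t)
    (R := edgeWeight μ z * (μ / 2 * sinh (2 * z)))
    (r := z * (q + 2 * (cosh (2 * z) / sinh (2 * z)))) (u := u) (v := v)
    (m := μ / 2 * exp (2 * u - 4 * z)) (n := μ / 2 * exp (2 * v - 4 * z)) hμ (by positivity)
    (exp_pos _) ht1 (mul_nonneg (by linarith [hs.2]) hz.le)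
    (mul_nonneg (by linarith [hk.2]) hz.le)
    (mul_le_mul_of_nonneg_right (by linarith [hs.1]) hz.le)
    (mul_le_mul_of_nonneg_right (by linarith [hk.1]) hz.le) (by positivity) (by positivity) ?_ ?_
  · have := mul_le_mul_of_nonneg_right key (mul_pos (exp_pos (-u)) (exp_pos (-v))).le
    have hc : μ * cosh (2 * z) = μ * (cosh (2 * z) / sinh (2 * z) * sinh (2 * z)) := by
      rw [hratio]
    rw [hc]
    unfold edgeProfile
    rw [← hu, ← hv, h3s, h3k, huv]
    rw [← sub_nonpos] at this
    refine le_of_eq_of_le ?_ this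
    rw [hu, hv]
    ring
  · have hqle' : q * (1 - t) ≤ 2 * (1 - t) - 4 * (1 + t) := by
      refine le_of_mul_le_mul_left ?_ (exp_pos (2 * z))
      rw [hsinh_eq, hcosh_eq] at hqle
      linarith
    have : cosh (2 * z) / sinh (2 * z) * (1 - t) = 1 + t := by
      have := sub_pos.2 ht1
      rw [hsinh_eq, hcosh_eq]
      field_simp
    nlinarith
  · have hD := edgeDenominator_pos hμ1 hz
    have hS := mul_le_half_mul_sinh (by linarith : 0 ≤ μ) hz.le
    unfold edgeWeight
    rw [div_mul_eq_mul_div, div_mul_eq_mul_div, div_mul_eq_mul_div, div_le_iff₀ hD]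
    have hS2 : (μ * z) ^ 2 ≤ (μ / 2 * sinh (2 * z)) ^ 2 := by gcongr
    have : exp (2 * z) * (1 - t) = 2 * sinh (2 * z) := by rw [hsinh_eq]; ring
    have e : exp (2 * z) * (μ / 2 * sinh (2 * z)) * (1 - t) * (μ ^ 2 - 1)
        = μ * sinh (2 * z) ^ 2 * (μ ^ 2 - 1) := by
      linear_combination (μ / 2 * sinh (2 * z)) * (μ ^ 2 - 1) * this
    rw [e]
    nlinarith

lemma edgeProfile_mul_exp (μ s z : ℝ) :
    edgeProfile μ s z * exp z =
      (1 / 2 + (1 - s) * z) * exp (s * z) + μ / 2 * exp (-(2 * z)) * exp (-(s * z)) := by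
  have h1 : exp (s * z) = exp (-((1 - s) * z)) * exp z := by rw [← exp_add]; ring_nf
  have h2 : exp (-((3 + s) * z)) * exp z = exp (-(2 * z)) * exp (-(s * z)) := by
    rw [← exp_add, ← exp_add]; ring_nf
  unfold edgeProfile
  linear_combination μ / 2 * h2 - (1 / 2 + (1 - s) * z) * h1

lemma even_numerator_eq {σ : ℝ} (hσ : 1 - σ ≠ 0) (s k z : ℝ) :
    cosh (s * z) * (zeta σ k z + z * psi σ k z) - s * z * sinh (s * z) * psi σ k z =
      (1 - σ) * exp z *
        ((edgeProfile ((3 + σ) / (1 - σ)) s z + edgeProfile ((3 + σ) / (1 - σ)) (-s) z) / 2 * exp z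
          * ((edgeProfile ((3 + σ) / (1 - σ)) k z + edgeProfile ((3 + σ) / (1 - σ)) (-k) z) / 2
            * exp z)
        + (3 + σ) / (1 - σ) * exp (-(2 * z)) * ((3 + σ) / (1 - σ) / 2 * sinh (2 * z) - z)
          * cosh (s * z) * cosh (k * z)) := by
  have h2 : exp (2 * z) = exp z ^ 2 := by rw [← exp_nat_mul]; norm_num
  simp only [div_mul_eq_mul_div, add_mul (edgeProfile _ _ _), edgeProfile_mul_exp, zeta, psi,
    cosh_eq, sinh_eq, exp_neg, neg_mul, neg_neg, h2]
  have hz := exp_ne_zero z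
  have hs := exp_ne_zero (s * z)
  have hk := exp_ne_zero (k * z)
  field_simp
  ring

lemma odd_numerator_eq {σ : ℝ} (hσ : 1 - σ ≠ 0) (s k z : ℝ) :
    sinh (s * z) * (eta σ k z + z * xi σ k z) - s * z * cosh (s * z) * xi σ k z =
      (1 - σ) * exp z *
        ((edgeProfile ((3 + σ) / (1 - σ)) s z - edgeProfile ((3 + σ) / (1 - σ)) (-s) z) / 2 * exp z
          * ((edgeProfile ((3 + σ) / (1 - σ)) k z - edgeProfile ((3 + σ) / (1 - σ)) (-k) z) / 2
            * exp z)
        + (3 + σ) / (1 - σ) * exp (-(2 * z)) * ((3 + σ) / (1 - σ) / 2 * sinh (2 * z) + z)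
          * sinh (s * z) * sinh (k * z)) := by
  have h2 : exp (2 * z) = exp z ^ 2 := by rw [← exp_nat_mul]; norm_num
  simp only [div_mul_eq_mul_div, sub_mul (edgeProfile _ _ _), edgeProfile_mul_exp, eta, xi,
    cosh_eq, sinh_eq, exp_neg, neg_mul, neg_neg, h2]
  have hz := exp_ne_zero z
  have hs := exp_ne_zero (s * z)
  have hk := exp_ne_zero (k * z)
  field_simp
  ring

/-- `exp (-z) * g` splits into products of edge profiles and two decaying exponentials. -/
lemma exp_neg_mul_g_eq {σ s k z : ℝ} (hσ0 : 0 ≤ σ) (hσ1 : σ < 1) (hz : 0 < z) :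
    exp (-z) * g σ s k z =
      1 / 2 * (sameEdge ((3 + σ) / (1 - σ)) s k z + sameEdge ((3 + σ) / (1 - σ)) (-s) (-k) z
        + (oppositeEdge ((3 + σ) / (1 - σ)) s k z
          + oppositeEdge ((3 + σ) / (1 - σ)) (-s) (-k) z)) := by
  have ha : 0 < 1 - σ := by linarith
  have heven := even_numerator_eq ha.ne' s k z
  have hodd := odd_numerator_eq ha.ne' s k z
  have hσμ : 3 + σ = (1 - σ) * ((3 + σ) / (1 - σ)) := by field_simp
  have hμ : 1 < (3 + σ) / (1 - σ) := by rw [lt_div_iff₀ ha]; linarith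
  have hF : F σ z = (1 - σ) * ((3 + σ) / (1 - σ) / 2 * sinh (2 * z) - z) := by
    unfold F; linear_combination sinh (2 * z) / 2 * hσμ
  have hFbar : Fbar σ z = (1 - σ) * ((3 + σ) / (1 - σ) / 2 * sinh (2 * z) + z) := by
    unfold Fbar; linear_combination sinh (2 * z) / 2 * hσμ
  have hSz := mul_le_half_mul_sinh (by linarith : 0 ≤ (3 + σ) / (1 - σ)) hz.le
  have hg : g σ s k z =
      (cosh (s * z) * (zeta σ k z + z * psi σ k z) - s * z * sinh (s * z) * psi σ k z) / F σ z
      + (sinh (s * z) * (eta σ k z + z * xi σ k z) - s * z * cosh (s * z) * xi σ k z)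
        / Fbar σ z := by
    unfold g; ring
  rw [hg, heven, hodd, hF, hFbar]
  unfold sameEdge oppositeEdge edgeWeight
  set μ := (3 + σ) / (1 - σ)
  set S := μ / 2 * sinh (2 * z)
  have hm : 0 < S - z := by nlinarith
  have hp : 0 < S + z := by linarith
  have hcosh : exp (-((2 - s - k) * z)) + exp (-((2 - -s - -k) * z)) =
      2 * exp (-(2 * z)) * (cosh (s * z) * cosh (k * z) + sinh (s * z) * sinh (k * z)) := by
    have h1 : exp (-((2 - s - k) * z)) = exp (-(2 * z)) * exp (s * z + k * z) := by
      rw [← exp_add]; ring_nf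
    have h2 : exp (-((2 - -s - -k) * z)) = exp (-(2 * z)) * exp (-(s * z + k * z)) := by
      rw [← exp_add]; ring_nf
    rw [← cosh_add, cosh_eq, h1, h2]
    ring
  have hD : S ^ 2 - z ^ 2 = (S - z) * (S + z) := by ring
  have hexp : exp (2 * z) = exp z ^ 2 := by rw [← exp_nat_mul]; norm_num
  rw [exp_neg z, hD, hexp, neg_neg]
  set W₁ := edgeProfile μ s z
  set W₂ := edgeProfile μ (-s) z
  set W₃ := edgeProfile μ k z
  set W₄ := edgeProfile μ (-k) z
  have hz0 := exp_ne_zero z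
  trans exp z ^ 2 * ((W₁ + W₂) * (W₃ + W₄) / (4 * (S - z)) + (W₁ - W₂) * (W₃ - W₄) / (4 * (S + z)))
    + μ / 2 * (exp (-((2 - s - k) * z)) + exp (-((2 - -s - -k) * z)))
  · rw [hcosh]
    field_simp
    ring
  · field_simp
    ring

/-- For fixed σ ∈ [0,1) and k, s ∈ [−1,1], the function z ↦ exp(−z)·g(s,k,z) is
strictly decreasing on (0,∞); equivalently g_z(s,k,z) − g(s,k,z) < 0 for all z > 0. -/
theorem exp_mul_g_strictAnti (σ : ℝ) (hσ0 : 0 ≤ σ) (hσ1 : σ < 1)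
    (k s : ℝ) (hk : k ∈ Set.Icc (-1 : ℝ) 1) (hs : s ∈ Set.Icc (-1 : ℝ) 1) :
    StrictAntiOn (fun z : ℝ => Real.exp (-z) * g σ s k z) (Set.Ioi 0) ∧
      ∀ z : ℝ, 0 < z → deriv (g σ s k) z - g σ s k z < 0 := by
  have hμ : 3 ≤ (3 + σ) / (1 - σ) := by
    rw [le_div_iff₀ (by linarith)]; linarith
  have hμ1 : 1 < (3 + σ) / (1 - σ) := by linarith
  have neg_mem : ∀ {x : ℝ}, x ∈ Set.Icc (-1 : ℝ) 1 → -x ∈ Set.Icc (-1 : ℝ) 1 :=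
    fun h => ⟨by linarith [h.2], by linarith [h.1]⟩
  have hderiv : ∀ z : ℝ, 0 < z →
      ∃ d < 0, HasDerivAt (fun z : ℝ => exp (-z) * g σ s k z) d z := by
    intro z hz
    obtain ⟨d₁, hd₁, h₁⟩ := exists_hasDerivAt_sameEdge hμ hs hk hz
    obtain ⟨d₂, hd₂, h₂⟩ := exists_hasDerivAt_sameEdge hμ (neg_mem hs) (neg_mem hk) hz
    obtain ⟨d₃, hd₃, h₃⟩ := exists_hasDerivAt_oppositeEdge hμ1 hs hk hz
    obtain ⟨d₄, hd₄, h₄⟩ := exists_hasDerivAt_oppositeEdge hμ1 (neg_mem hs)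
      (neg_mem hk) hz
    refine ⟨1 / 2 * (d₁ + d₂ + (d₃ + d₄)), by linarith,
      (((h₁.add h₂).add (h₃.add h₄)).const_mul (1 / 2)).congr_of_eventuallyEq ?_⟩
    filter_upwards [Ioi_mem_nhds hz] with y hy
    exact exp_neg_mul_g_eq hσ0 hσ1 hy
  constructor
  · apply strictAntiOn_of_deriv_neg (convex_Ioi 0)
    · intro z hz
      obtain ⟨d, -, h⟩ := hderiv z hz
      exact h.continuousAt.continuousWithinAt
    · intro z hz
      rw [interior_Ioi] at hz
      obtain ⟨d, hd, h⟩ := hderiv z hz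
      rwa [h.deriv]
  · intro z hz
    obtain ⟨d, hd, h⟩ := hderiv z hz
    have hg : HasDerivAt (g σ s k) (exp z * (exp (-z) * g σ s k z) + exp z * d) z := by
      refine ((hasDerivAt_exp z).mul h).congr_of_eventuallyEq (Filter.Eventually.of_forall ?_)
      intro y
      simp only [Pi.mul_apply]
      rw [← mul_assoc, ← exp_add, add_neg_cancel, exp_zero, one_mul]
    rw [hg.deriv, ← mul_assoc, ← exp_add, add_neg_cancel, exp_zero, one_mul]
    linarith [mul_neg_of_pos_of_neg (exp_pos z) hd]
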